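/- Let 𝒢 be an ultragraph with at least one edge, 𝔽 the free group on 𝒢¹, and R a nonzero unital commutative ring. Then L_R(𝒢) is strongly 𝔽-graded with respect to the grading {L_R(𝒢)_g}_{g∈𝔽} if and only if 𝒢 has exactly one edge e and exactly one vertex, namely G⁰ = {s(e)} and r(e) = {s(e)}. -/

import Mathlib

/-- An ultragraph: a source map `src : E → V` and a range map assigning to each
edge a nonempty set of vertices. -/
structure Ultragraph (V : Type) (E : Type) : Type where
  src : E → V
  rng : E → Set V
  rng_nonempty : ∀ e, (rng e).Nonempty

namespace Ultragraph

variable {V E : Type}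

/-- A finite path: a (possibly empty) list of edges with compatible transitions. -/
def IsPath (G : Ultragraph V E) (es : List E) : Prop :=
  es.Chain' fun e f => G.src f ∈ G.rng e

/-- An infinite path. -/
def IsInfinitePath (G : Ultragraph V E) (p : ℕ → E) : Prop :=
  ∀ i : ℕ, G.src (p (i + 1)) ∈ G.rng (p i)

/-- Condition (Y). -/
def ConditionY (G : Ultragraph V E) : Prop :=
  ∀ p : ℕ → E, G.IsInfinitePath p →
    ∃ (k : ℕ) (α : List E) (hα : α ≠ []),
      α.length = k + 1 ∧ G.IsPath α ∧ G.src (p k) ∈ G.rng (α.getLast hα)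

/-- The collection 𝒢⁰ of generalized vertices: the smallest collection of subsets of `V`
containing the singletons and the ranges of edges, closed under finite unions and finite
intersections (the empty set is included for convenience; `p_∅ = 0`). -/
inductive InG0 (G : Ultragraph V E) : Set V → Prop
  | vertex (v : V) : InG0 G {v}
  | range (e : E) : InG0 G (G.rng e)
  | union {A B : Set V} : InG0 G A → InG0 G B → InG0 G (A ∪ B)
  | inter {A B : Set V} : InG0 G A → InG0 G B → InG0 G (A ∩ B)

/-- Generators of the Leavitt path algebra. -/
inductive LPAGen (G : Ultragraph V E) : Type
  | edge : E → LPAGen G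
  | star : E → LPAGen G
  | proj : (A : Set V) → G.InG0 A → LPAGen G

/-- The directed graph `E_𝒢` associated to an ultragraph, viewed again as an ultragraph
whose edge ranges are singletons. -/
def toGraph (G : Ultragraph V E) : Ultragraph V {q : E × V // q.2 ∈ G.rng q.1} where
  src q := G.src q.1.1
  rng q := {q.1.2}
  rng_nonempty q := ⟨q.1.2, rfl⟩

variable (R : Type) [CommRing R] (G : Ultragraph V E)

/-- The free `R`-algebra on the generators. -/
abbrev FA := FreeAlgebra R (LPAGen G)

/-- The generator `g` inside the free algebra. -/
def X (g : LPAGen G) : FA R G := FreeAlgebra.ι R g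

/-- The defining relations of the Leavitt path algebra of an ultragraph. -/
inductive LeavittRel : FA R G → FA R G → Prop
  | proj_empty (h : G.InG0 ∅) : LeavittRel (X R G (.proj ∅ h)) 0
  | proj_mul (A B : Set V) (hA : G.InG0 A) (hB : G.InG0 B) :
      LeavittRel (X R G (.proj A hA) * X R G (.proj B hB))
        (X R G (.proj (A ∩ B) (hA.inter hB)))
  | proj_union (A B : Set V) (hA : G.InG0 A) (hB : G.InG0 B) :
      LeavittRel (X R G (.proj (A ∪ B) (hA.union hB)))
        (X R G (.proj A hA) + X R G (.proj B hB) - X R G (.proj (A ∩ B) (hA.inter hB)))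
  | src_mul (e : E) :
      LeavittRel (X R G (.proj {G.src e} (InG0.vertex (G.src e))) * X R G (.edge e))
        (X R G (.edge e))
  | mul_rng (e : E) :
      LeavittRel (X R G (.edge e) * X R G (.proj (G.rng e) (InG0.range e)))
        (X R G (.edge e))
  | rng_mul_star (e : E) :
      LeavittRel (X R G (.proj (G.rng e) (InG0.range e)) * X R G (.star e))
        (X R G (.star e))
  | star_mul_src (e : E) :
      LeavittRel (X R G (.star e) * X R G (.proj {G.src e} (InG0.vertex (G.src e))))
        (X R G (.star e))
  | star_mul_same (e : E) :
      LeavittRel (X R G (.star e) * X R G (.edge e))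
        (X R G (.proj (G.rng e) (InG0.range e)))
  | star_mul_ne (e f : E) (h : e ≠ f) :
      LeavittRel (X R G (.star e) * X R G (.edge f)) 0
  | ck (v : V) (hfin : {e : E | G.src e = v}.Finite) (hne : {e : E | G.src e = v}.Nonempty) :
      LeavittRel (X R G (.proj {v} (InG0.vertex v)))
        (∑ e ∈ hfin.toFinset, X R G (.edge e) * X R G (.star e))

/-- The (unital) quotient of the free algebra by the Leavitt relations; the Leavitt
path algebra `L_R(𝒢)` sits inside it as the non-unital subalgebra generated by the
generators. -/
abbrev LPABig := RingQuot (LeavittRel R G)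

/-- The image of a generator in the quotient. -/
def gen (g : LPAGen G) : LPABig R G := RingQuot.mkAlgHom R (LeavittRel R G) (X R G g)

/-- `s_e`. -/
def sgen (e : E) : LPABig R G := gen R G (.edge e)

/-- `s_e^*`. -/
def tgen (e : E) : LPABig R G := gen R G (.star e)

/-- `p_A`. -/
def pgen (A : Set V) (hA : G.InG0 A) : LPABig R G := gen R G (.proj A hA)

/-- `s_α` for a finite path `α` (the empty product is `1` in the ambient algebra). -/
def sPath (es : List E) : LPABig R G := (es.map (sgen R G)).prod

/-- `s_β^*` for a finite path `β`. -/
def tPath (es : List E) : LPABig R G := (es.reverse.map (tgen R G)).prod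

/-- The monomial `s_α p_A s_β^*`. -/
def mono (α : List E) (A : Set V) (hA : G.InG0 A) (β : List E) : LPABig R G :=
  sPath R G α * pgen R G A hA * tPath R G β

/-- The `m`-th component of the canonical `ℤ`-grading: all finite `R`-linear combinations
of monomials `s_α p_A s_β^*` with `|α| - |β| = m`. -/
def zComp (m : ℤ) : AddSubgroup (LPABig R G) :=
  AddSubgroup.closure {x | ∃ (l : R) (α β : List E) (A : Set V) (hA : G.InG0 A),
    G.IsPath α ∧ G.IsPath β ∧ (α.length : ℤ) - (β.length : ℤ) = m ∧
    x = l • mono R G α A hA β}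

/-- The element of the free group on the edges determined by a finite path. -/
def pathWord (es : List E) : FreeGroup E := (es.map FreeGroup.of).prod

/-- The `g`-th component of the free-group grading: all finite `R`-linear combinations
of monomials `s_α p_A s_β^*` with `α β⁻¹ = g` in the free group on the edges. -/
def fComp (g : FreeGroup E) : AddSubgroup (LPABig R G) :=
  AddSubgroup.closure {x | ∃ (l : R) (α β : List E) (A : Set V) (hA : G.InG0 A),
    G.IsPath α ∧ G.IsPath β ∧ pathWord α * (pathWord β)⁻¹ = g ∧
    x = l • mono R G α A hA β}

/-- The set of generators inside the quotient. -/
def genSet : Set (LPABig R G) := Set.range (gen R G)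

/-- The Leavitt path algebra `L_R(𝒢)`: the non-unital subalgebra of the quotient
generated by the images of the generators. -/
def LPA : NonUnitalSubalgebra R (LPABig R G) := NonUnitalAlgebra.adjoin R (genSet R G)

/-- `s_e` as an element of `L_R(𝒢)`. -/
def sEl (e : E) : LPA R G :=
  ⟨sgen R G e, NonUnitalAlgebra.subset_adjoin R ⟨LPAGen.edge e, rfl⟩⟩

/-- `s_e^*` as an element of `L_R(𝒢)`. -/
def tEl (e : E) : LPA R G :=
  ⟨tgen R G e, NonUnitalAlgebra.subset_adjoin R ⟨LPAGen.star e, rfl⟩⟩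

/-- `p_A` as an element of `L_R(𝒢)`. -/
def pEl (A : Set V) (hA : G.InG0 A) : LPA R G :=
  ⟨pgen R G A hA, NonUnitalAlgebra.subset_adjoin R ⟨LPAGen.proj A hA, rfl⟩⟩

end Ultragraph

/-- The additive span of the set of products `{a b : a ∈ S, b ∈ T}`. -/
def mulSpan {A : Type} [AddGroup A] [Mul A] (S T : AddSubgroup A) : AddSubgroup A :=
  AddSubgroup.closure {x | ∃ a ∈ S, ∃ b ∈ T, x = a * b}

namespace Ultragraph

variable {V E : Type}

theorem pathWord_eq_mk (es : List E) :
    pathWord es = FreeGroup.mk (es.map fun e => (e, true)) := by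
  induction es with
  | nil => rfl
  | cons e es ih =>
    have h : pathWord (e :: es) = FreeGroup.of e * pathWord es := by simp [pathWord]
    rw [h, ih, FreeGroup.of, FreeGroup.mul_mk]
    rfl

theorem pathWord_injective : Function.Injective (pathWord (E := E)) := by
  classical
  have hred (es : List E) : FreeGroup.IsReduced (es.map fun e => (e, true)) := by
    refine (List.isChain_map _).2 ?_
    exact List.isChain_iff_forall_rel_of_append_cons_cons.2 fun _ _ _ _ _ _ => rfl
  intro α β h
  have h' := congrArg FreeGroup.toWord h
  rw [pathWord_eq_mk, pathWord_eq_mk, FreeGroup.toWord_mk, FreeGroup.toWord_mk,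
    (hred α).reduce_eq, (hred β).reduce_eq] at h'
  exact List.map_injective_iff.2 (fun a b hab => congrArg Prod.fst hab) h'

theorem pathWord_cons (e : E) (es : List E) :
    pathWord (e :: es) = FreeGroup.of e * pathWord es := by
  simp [pathWord]

theorem pathWord_append (α β : List E) : pathWord (α ++ β) = pathWord α * pathWord β := by
  simp [pathWord]

/-- An algebraic branching system on `V × ℕ`: the maps `map e`, restricted to the part lying over
the range of `e`, are injective with disjoint images covering the fibres over all sources. -/
structure BranchingSystem (G : Ultragraph V E) where
  map : E → V × ℕ → V × ℕ
  fst_map : ∀ e x, (map e x).1 = G.src e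
  inj : ∀ {e f x y}, x.1 ∈ G.rng e → y.1 ∈ G.rng f → map e x = map f y → e = f ∧ x = y
  surj : ∀ e y, y.1 = G.src e → ∃ f x, x.1 ∈ G.rng f ∧ map f x = y

theorem nonempty_branchingSystem [Countable V] [Countable E] (G : Ultragraph V E) :
    Nonempty G.BranchingSystem := by
  classical
  let D (v : V) : Type := {p : E × V × ℕ // G.src p.1 = v ∧ p.2.1 ∈ G.rng p.1}
  have hD (v : V) (hv : ∃ e, G.src e = v) : Nonempty (D v ≃ ℕ) := by
    obtain ⟨e, rfl⟩ := hv
    obtain ⟨w, hw⟩ := G.rng_nonempty e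
    have : Infinite (D (G.src e)) :=
      Infinite.of_injective (fun n : ℕ => (⟨(e, w, n), rfl, hw⟩ : D (G.src e))) fun m n h => by
        simpa [D] using h
    have : Countable (D (G.src e)) := Subtype.countable
    exact nonempty_equiv_of_countable
  have φ (v : V) (hv : ∃ e, G.src e = v) : D v ≃ ℕ := Classical.choice (hD v hv)
  have key (v w : V) (hv hw) (d : D v) (d' : D w) (hvw : v = w) :
      φ v hv d = φ w hw d' ↔ d.1 = d'.1 := by
    subst hvw
    rw [(φ v hv).apply_eq_iff_eq, Subtype.ext_iff]
  refine ⟨⟨fun e x => (G.src e,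
    if hx : x.1 ∈ G.rng e then φ (G.src e) ⟨e, rfl⟩ ⟨(e, x), rfl, hx⟩ else 0),
    fun _ _ => rfl, ?_, ?_⟩⟩
  · intro e f x y hx hy h
    simp only [hx, hy, dif_pos, Prod.mk.injEq] at h
    simpa using (key _ _ _ _ _ _ h.1).1 h.2
  · rintro e ⟨v, n⟩ rfl
    obtain ⟨⟨⟨f, x⟩, hf, hx⟩, rfl⟩ := (φ (G.src e) ⟨e, rfl⟩).surjective n
    refine ⟨f, x, hx, ?_⟩
    change G.src f = G.src e at hf
    simp only at hx
    simp only [hx, dif_pos, Prod.mk.injEq, hf, true_and]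
    exact (key _ _ _ _ _ _ hf).2 rfl

namespace BranchingSystem

variable {G : Ultragraph V E} (B : G.BranchingSystem) (R : Type) [CommRing R]

open Classical in
/-- The operator representing `p_A`. -/
noncomputable def projOp (A : Set V) : Module.End R (V × ℕ → R) where
  toFun f x := if x.1 ∈ A then f x else 0
  map_add' f g := by ext x; simp only [Pi.add_apply]; split_ifs <;> simp
  map_smul' c f := by ext x; simp

open Classical in
/-- The operator representing `s_e^*`. -/
noncomputable def starOp (e : E) : Module.End R (V × ℕ → R) where
  toFun f x := if x.1 ∈ G.rng e then f (B.map e x) else 0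
  map_add' f g := by ext x; simp only [Pi.add_apply]; split_ifs <;> simp
  map_smul' c f := by ext x; simp

open Classical in
/-- The operator representing `s_e`. -/
noncomputable def edgeOp (e : E) : Module.End R (V × ℕ → R) where
  toFun f y := if h : ∃ x, x.1 ∈ G.rng e ∧ B.map e x = y then f h.choose else 0
  map_add' f g := by ext x; simp only [Pi.add_apply]; split_ifs <;> simp
  map_smul' c f := by ext x; simp

variable {R}

open Classical in
theorem projOp_apply (A : Set V) (f : V × ℕ → R) (x : V × ℕ) :
    projOp R A f x = if x.1 ∈ A then f x else 0 := rfl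

open Classical in
theorem starOp_apply (e : E) (f : V × ℕ → R) (x : V × ℕ) :
    B.starOp R e f x = if x.1 ∈ G.rng e then f (B.map e x) else 0 := rfl

theorem edgeOp_map {e : E} {x : V × ℕ} (hx : x.1 ∈ G.rng e) (f : V × ℕ → R) :
    B.edgeOp R e f (B.map e x) = f x := by
  have h : ∃ z : V × ℕ, z.1 ∈ G.rng e ∧ B.map e z = B.map e x := ⟨x, hx, rfl⟩
  refine (dif_pos h).trans ?_
  rw [(B.inj h.choose_spec.1 hx h.choose_spec.2).2]

theorem edgeOp_of_not {e : E} {y : V × ℕ} (hy : ¬ ∃ x, x.1 ∈ G.rng e ∧ B.map e x = y)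
    (f : V × ℕ → R) : B.edgeOp R e f y = 0 :=
  dif_neg hy

theorem edgeOp_map_ne {e e' : E} (hne : e ≠ e') {x : V × ℕ} (hx : x.1 ∈ G.rng e)
    (f : V × ℕ → R) : B.edgeOp R e' f (B.map e x) = 0 :=
  B.edgeOp_of_not (fun ⟨_, hz, h⟩ => hne (B.inj hz hx h).1.symm) f

variable (R)

/-- The images of the generators under the representation attached to a branching system. -/
noncomputable def genOp : LPAGen G → Module.End R (V × ℕ → R)
  | .edge e => B.edgeOp R e
  | .star e => B.starOp R e
  | .proj A _ => projOp R A

theorem lift_genOp_eq {x y : FA R G} (h : LeavittRel R G x y) :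
    FreeAlgebra.lift R (B.genOp R) x = FreeAlgebra.lift R (B.genOp R) y := by
  classical
  induction h with
  | proj_empty h =>
    ext f x
    simp [X, genOp, projOp_apply]
  | proj_mul A C hA hC =>
    refine LinearMap.ext fun f => funext fun x => ?_
    by_cases h₁ : x.1 ∈ A <;> by_cases h₂ : x.1 ∈ C <;> simp [X, genOp, projOp_apply, h₁, h₂]
  | proj_union A C hA hC =>
    refine LinearMap.ext fun f => funext fun x => ?_
    by_cases h₁ : x.1 ∈ A <;> by_cases h₂ : x.1 ∈ C <;> simp [X, genOp, projOp_apply, h₁, h₂]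
  | src_mul e =>
    refine LinearMap.ext fun f => funext fun x => ?_
    by_cases h : ∃ z, z.1 ∈ G.rng e ∧ B.map e z = x
    · obtain ⟨z, hz, rfl⟩ := h
      simp [X, genOp, projOp_apply, B.fst_map]
    · simp [X, genOp, projOp_apply, B.edgeOp_of_not h]
  | mul_rng e =>
    refine LinearMap.ext fun f => funext fun x => ?_
    by_cases h : ∃ z, z.1 ∈ G.rng e ∧ B.map e z = x
    · obtain ⟨z, hz, rfl⟩ := h
      simp [X, genOp, projOp_apply, B.edgeOp_map hz, hz]
    · simp [X, genOp, B.edgeOp_of_not h]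
  | rng_mul_star e =>
    refine LinearMap.ext fun f => funext fun x => ?_
    by_cases h : x.1 ∈ G.rng e <;> simp [X, genOp, projOp_apply, starOp_apply, h]
  | star_mul_src e =>
    refine LinearMap.ext fun f => funext fun x => ?_
    simp [X, genOp, projOp_apply, starOp_apply, B.fst_map]
  | star_mul_same e =>
    refine LinearMap.ext fun f => funext fun x => ?_
    by_cases h : x.1 ∈ G.rng e
    · simp [X, genOp, projOp_apply, starOp_apply, h, B.edgeOp_map h]
    · simp [X, genOp, projOp_apply, starOp_apply, h]
  | star_mul_ne e e' hne =>
    refine LinearMap.ext fun f => funext fun x => ?_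
    by_cases h : x.1 ∈ G.rng e
    · simp [X, genOp, starOp_apply, h, B.edgeOp_map_ne hne h]
    · simp [X, genOp, starOp_apply, h]
  | ck v hfin hne =>
    refine LinearMap.ext fun f => funext fun x => ?_
    simp only [X, genOp, map_sum, map_mul, FreeAlgebra.lift_ι_apply, LinearMap.sum_apply,
      Finset.sum_apply, Module.End.mul_apply]
    by_cases hx : x.1 = v
    · obtain ⟨e₀, he₀⟩ := hne
      obtain ⟨e, z, hz, rfl⟩ := B.surj e₀ x (hx.trans he₀.symm)
      have hev : G.src e = v := by rw [← hx, B.fst_map]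
      rw [Finset.sum_eq_single e (fun e' _ h => B.edgeOp_map_ne h.symm hz _)
        (fun h => absurd (by simpa using hev) h), B.edgeOp_map hz]
      simp [projOp_apply, starOp_apply, hz, hx]
    · rw [Finset.sum_eq_zero]
      · simp [projOp_apply, hx]
      · intro e he
        refine B.edgeOp_of_not ?_ _
        rintro ⟨z, -, rfl⟩
        exact hx ((B.fst_map e z).trans (by simpa using he))

/-- The representation of the Leavitt path algebra attached to a branching system. -/
noncomputable def rep : LPABig R G →ₐ[R] Module.End R (V × ℕ → R) :=
  RingQuot.liftAlgHom R
    ⟨FreeAlgebra.lift R (B.genOp R), fun _ _ h => B.lift_genOp_eq R h⟩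

theorem rep_pgen (A : Set V) (hA : G.InG0 A) : B.rep R (pgen R G A hA) = projOp R A := by
  simp [rep, pgen, gen, X, genOp]

end BranchingSystem

section Relations

variable (R : Type) [CommRing R] (G : Ultragraph V E)

theorem pgen_vertex_ne_zero [Countable V] [Countable E] [Nontrivial R] (v : V) :
    pgen R G {v} (.vertex v) ≠ 0 := by
  obtain ⟨B⟩ := G.nonempty_branchingSystem
  intro h
  have h₁ := B.rep_pgen R {v} (.vertex v)
  rw [h, map_zero] at h₁
  have h₂ := congrFun (LinearMap.congr_fun h₁ fun _ => (1 : R)) (v, 0)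
  simp [BranchingSystem.projOp_apply] at h₂

variable {R G}

theorem mkAlgHom_eq {x y : FA R G} (h : LeavittRel R G x y) :
    RingQuot.mkAlgHom R (LeavittRel R G) x = RingQuot.mkAlgHom R (LeavittRel R G) y :=
  RingQuot.mkAlgHom_rel R h

theorem pgen_empty (h : G.InG0 ∅) : pgen R G ∅ h = 0 := by
  simpa [pgen, gen] using mkAlgHom_eq (LeavittRel.proj_empty (R := R) h)

theorem pgen_mul (A C : Set V) (hA : G.InG0 A) (hC : G.InG0 C) :
    pgen R G A hA * pgen R G C hC = pgen R G (A ∩ C) (hA.inter hC) := by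
  simpa [pgen, gen] using mkAlgHom_eq (LeavittRel.proj_mul (R := R) A C hA hC)

theorem pgen_src_mul_sgen (e : E) :
    pgen R G {G.src e} (.vertex (G.src e)) * sgen R G e = sgen R G e := by
  simpa [pgen, sgen, gen] using mkAlgHom_eq (LeavittRel.src_mul (R := R) (G := G) e)

theorem sgen_mul_pgen_rng (e : E) :
    sgen R G e * pgen R G (G.rng e) (.range e) = sgen R G e := by
  simpa [pgen, sgen, gen] using mkAlgHom_eq (LeavittRel.mul_rng (R := R) (G := G) e)

theorem pgen_rng_mul_tgen (e : E) :
    pgen R G (G.rng e) (.range e) * tgen R G e = tgen R G e := by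
  simpa [pgen, tgen, gen] using mkAlgHom_eq (LeavittRel.rng_mul_star (R := R) (G := G) e)

theorem tgen_mul_pgen_src (e : E) :
    tgen R G e * pgen R G {G.src e} (.vertex (G.src e)) = tgen R G e := by
  simpa [pgen, tgen, gen] using mkAlgHom_eq (LeavittRel.star_mul_src (R := R) (G := G) e)

theorem tgen_mul_sgen (e : E) :
    tgen R G e * sgen R G e = pgen R G (G.rng e) (.range e) := by
  simpa [pgen, tgen, sgen, gen] using
    mkAlgHom_eq (LeavittRel.star_mul_same (R := R) (G := G) e)

theorem pgen_vertex_eq_sum (v : V) (hfin : {e : E | G.src e = v}.Finite)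
    (hne : {e : E | G.src e = v}.Nonempty) :
    pgen R G {v} (.vertex v) = ∑ e ∈ hfin.toFinset, sgen R G e * tgen R G e := by
  simpa [pgen, tgen, sgen, gen] using
    mkAlgHom_eq (LeavittRel.ck (R := R) (G := G) v hfin hne)

theorem pgen_mem_fComp_one (A : Set V) (hA : G.InG0 A) : pgen R G A hA ∈ fComp R G 1 :=
  AddSubgroup.subset_closure ⟨1, [], [], A, hA, List.isChain_nil, List.isChain_nil,
    by simp [pathWord], by simp [mono, sPath, tPath]⟩

theorem mulSpan_bot_left (S : AddSubgroup (LPABig R G)) : mulSpan ⊥ S = ⊥ := by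
  rw [mulSpan, AddSubgroup.closure_eq_bot_iff]
  rintro _ ⟨a, ha, b, -, rfl⟩
  simp [AddSubgroup.mem_bot.1 ha]

theorem fComp_inv_mul_eq_bot {e f : E} (hef : e ≠ f) :
    fComp R G ((FreeGroup.of e)⁻¹ * FreeGroup.of f) = ⊥ := by
  rw [fComp, AddSubgroup.closure_eq_bot_iff]
  rintro _ ⟨l, α, β, A, hA, -, -, hw, -⟩
  refine absurd ?_ hef
  have h : pathWord (e :: α) = pathWord (f :: β) := by
    rw [pathWord_cons, pathWord_cons, ← mul_inv_eq_iff_eq_mul, mul_assoc, hw,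
      mul_inv_cancel_left]
  exact (List.cons.inj (pathWord_injective h)).1

theorem pgen_src_mul_of_mem [Subsingleton E] {e : E} {x : LPABig R G}
    (hx : x ∈ fComp R G (FreeGroup.of e)) :
    pgen R G {G.src e} (.vertex (G.src e)) * x = x := by
  induction hx using AddSubgroup.closure_induction with
  | mem x hx =>
    obtain ⟨l, α, β, A, hA, -, -, hw, rfl⟩ := hx
    cases α with
    | nil =>
      have h : pathWord (e :: β) = pathWord [] := by
        rw [pathWord_cons, ← hw]
        simp [pathWord]
      exact absurd (pathWord_injective h) (List.cons_ne_nil e β)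
    | cons f α =>
      obtain rfl := Subsingleton.elim f e
      simp only [mono, sPath, List.map_cons, List.prod_cons, mul_smul_comm, ← mul_assoc,
        pgen_src_mul_sgen]
  | zero => simp
  | add x y _ _ hx hy => rw [mul_add, hx, hy]
  | neg x _ hx => exact (mul_neg _ x).trans (congrArg (-·) hx)

theorem pgen_src_mul_of_mem_mulSpan [Subsingleton E] {e : E} {S : AddSubgroup (LPABig R G)}
    {x : LPABig R G} (hx : x ∈ mulSpan (fComp R G (FreeGroup.of e)) S) :
    pgen R G {G.src e} (.vertex (G.src e)) * x = x := by
  induction hx using AddSubgroup.closure_induction with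
  | mem x hx =>
    obtain ⟨a, ha, b, -, rfl⟩ := hx
    rw [← mul_assoc, pgen_src_mul_of_mem ha]
  | zero => simp
  | add x y _ _ hx hy => rw [mul_add, hx, hy]
  | neg x _ hx => exact (mul_neg _ x).trans (congrArg (-·) hx)

theorem pgen_vertex_mul_of_ne {v w : V} (h : v ≠ w) :
    pgen R G {v} (.vertex v) * pgen R G {w} (.vertex w) = 0 := by
  have h₀ : ({v} : Set V) ∩ {w} = ∅ := by simpa using h.symm
  have h₁ : G.InG0 ∅ := h₀ ▸ (InG0.vertex v).inter (.vertex w)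
  rw [pgen_mul, ← pgen_empty h₁]
  congr 1

end Relations

section SingleLoop

variable {G : Ultragraph V E} {e : E}

theorem InG0.eq_singleton (hV : ∀ v : V, v = G.src e) {A : Set V} (hA : G.InG0 A) :
    A = {G.src e} := by
  induction hA with
  | vertex v => rw [hV v]
  | range f =>
    obtain ⟨w, hw⟩ := G.rng_nonempty f
    ext v
    rw [hV v]
    exact ⟨fun _ => rfl, fun _ => hV w ▸ hw⟩
  | union _ _ hA hB => rw [hA, hB, Set.union_self]
  | inter _ _ hA hB => rw [hA, hB, Set.inter_self]

theorem isPath_of_forall_src_mem (h : ∀ e f : E, G.src f ∈ G.rng e) (α : List E) :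
    G.IsPath α :=
  List.isChain_iff_forall_rel_of_append_cons_cons.2 fun a b _ _ _ => h a b

theorem commute_freeGroup [Subsingleton E] (g h : FreeGroup E) : g * h = h * g := by
  have : ∀ g : FreeGroup E, g ∈ Subgroup.closure (Set.range FreeGroup.of) := fun g => by
    simp [FreeGroup.closure_range_of]
  have hc := Subgroup.isMulCommutative_closure (k := Set.range (FreeGroup.of (α := E))) (by
    rintro _ ⟨a, rfl⟩ _ ⟨b, rfl⟩
    rw [Subsingleton.elim a b])
  exact congrArg Subtype.val (hc.is_comm.comm ⟨g, this g⟩ ⟨h, this h⟩)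

theorem exists_pathWord_eq [Subsingleton E] (g : FreeGroup E) :
    ∃ α β : List E, pathWord α * (pathWord β)⁻¹ = g := by
  induction g using FreeGroup.induction_on with
  | C1 => exact ⟨[], [], by simp⟩
  | of a => exact ⟨[a], [], by simp [pathWord]⟩
  | inv_of a _ => exact ⟨[], [a], by simp [pathWord]⟩
  | mul x y hx hy =>
    obtain ⟨α, β, rfl⟩ := hx
    obtain ⟨γ, δ, rfl⟩ := hy
    refine ⟨α ++ γ, β ++ δ, ?_⟩
    rw [pathWord_append, pathWord_append, mul_inv_rev, mul_assoc, mul_assoc,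
      commute_freeGroup (pathWord β)⁻¹, mul_assoc]

theorem pow_mul_mul_pow_mul {M : Type} [Monoid M] {s p t : M} (hp : p * p = p)
    (hsp : Commute s p) (hst : Commute s t) (htp : Commute t p) (a b c d : ℕ) :
    s ^ a * p * t ^ b * (s ^ c * p * t ^ d) = s ^ (a + c) * p * t ^ (b + d) := by
  have h₁ : t ^ b * (s ^ c * p) = s ^ c * p * t ^ b :=
    ((hst.symm.pow_pow b c).mul_right (htp.pow_left b)).eq
  have h₂ : p * (s ^ c * p) = s ^ c * p := by
    rw [← mul_assoc, ((hsp.pow_left c).eq).symm, mul_assoc, hp]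
  calc s ^ a * p * t ^ b * (s ^ c * p * t ^ d)
      = s ^ a * p * (t ^ b * (s ^ c * p)) * t ^ d := by simp only [mul_assoc]
    _ = s ^ a * (p * (s ^ c * p)) * (t ^ b * t ^ d) := by rw [h₁]; simp only [mul_assoc]
    _ = s ^ (a + c) * p * t ^ (b + d) := by rw [h₂, pow_add, pow_add]; simp only [mul_assoc]

theorem pow_add_mul_mul_pow_add {M : Type} [Monoid M] {s p t : M} (h : s * p * t = p)
    (a b k : ℕ) : s ^ (a + k) * p * t ^ (b + k) = s ^ a * p * t ^ b := by
  induction k with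
  | zero => rfl
  | succ k ih =>
    calc s ^ (a + (k + 1)) * p * t ^ (b + (k + 1))
        = s ^ (a + k) * (s * p * t) * t ^ (b + k) := by
          rw [← add_assoc, ← add_assoc, pow_succ, pow_succ']
          simp only [mul_assoc]
      _ = s ^ a * p * t ^ b := by rw [h, ih]

variable (R : Type) [CommRing R]

theorem mono_eq_pow [Subsingleton E] (hV : ∀ v : V, v = G.src e) (α β : List E) (A : Set V)
    (hA : G.InG0 A) :
    mono R G α A hA β = sgen R G e ^ α.length * pgen R G {G.src e} (.vertex (G.src e)) *
      tgen R G e ^ β.length := by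
  obtain rfl := hA.eq_singleton hV
  have hα : α = List.replicate α.length e :=
    List.eq_replicate_of_mem fun _ _ => Subsingleton.elim _ _
  have hβ : β = List.replicate β.length e :=
    List.eq_replicate_of_mem fun _ _ => Subsingleton.elim _ _
  rw [mono, hα, hβ]
  simp [sPath, tPath]

theorem pgen_congr {A C : Set V} (h : A = C) (hA : G.InG0 A) (hC : G.InG0 C) :
    pgen R G A hA = pgen R G C hC := by
  subst h
  rfl

theorem mulSpan_fComp_of_single_loop [Subsingleton E] (hV : ∀ v : V, v = G.src e)
    (g h : FreeGroup E) : mulSpan (fComp R G g) (fComp R G h) = fComp R G (g * h) := by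
  set s := sgen R G e
  set t := tgen R G e
  set p := pgen R G {G.src e} (.vertex (G.src e)) with hp
  have hrng : pgen R G (G.rng e) (.range e) = p :=
    pgen_congr R ((InG0.range e).eq_singleton hV) _ _
  have hpp : p * p = p := (pgen_mul _ _ _ _).trans (pgen_congr R (Set.inter_self _) _ _)
  have hps : p * s = s := pgen_src_mul_sgen e
  have hsp : s * p = s := by rw [← hrng]; exact sgen_mul_pgen_rng e
  have hpt : p * t = t := by rw [← hrng]; exact pgen_rng_mul_tgen e
  have htp : t * p = t := tgen_mul_pgen_src e
  have hts : t * s = p := (tgen_mul_sgen e).trans hrng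
  have hst : s * t = p := by
    have hset : {f : E | G.src f = G.src e} = {e} := by
      ext f
      simp [Subsingleton.elim f e]
    have hfin : {f : E | G.src f = G.src e}.Finite := Set.toFinite _
    have hfin' : hfin.toFinset = {e} := by
      ext f
      simp [Subsingleton.elim f e]
    rw [hp, pgen_vertex_eq_sum _ hfin ⟨e, rfl⟩, hfin', Finset.sum_singleton]
  have hspt : s * p * t = p := by rw [hsp, hst]
  have hpath (α : List E) : G.IsPath α := isPath_of_forall_src_mem (fun a b => by
    rw [(InG0.range a).eq_singleton hV]
    exact hV _) α
  have hmul := pow_mul_mul_pow_mul hpp (hsp.trans hps.symm) (hst.trans hts.symm)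
    (htp.trans hpt.symm)
  apply le_antisymm
  · have hclosure : ∀ x ∈ fComp R G g, ∀ y ∈ fComp R G h, x * y ∈ fComp R G (g * h) := by
      intro x hx y hy
      induction hx using AddSubgroup.closure_induction with
      | mem x hx =>
        obtain ⟨l, α, β, A, hA, -, -, rfl, rfl⟩ := hx
        induction hy using AddSubgroup.closure_induction with
        | mem y hy =>
          obtain ⟨m, γ, δ, C, hC, -, -, rfl, rfl⟩ := hy
          refine AddSubgroup.subset_closure
            ⟨l * m, α ++ γ, β ++ δ, A, hA, hpath _, hpath _, ?_, ?_⟩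
          · rw [pathWord_append, pathWord_append, mul_inv_rev,
              commute_freeGroup (pathWord δ)⁻¹, mul_assoc, mul_assoc, ← mul_assoc (pathWord γ),
              commute_freeGroup (pathWord γ), mul_assoc]
          · rw [mono_eq_pow R hV, mono_eq_pow R hV, mono_eq_pow R hV, smul_mul_smul_comm, hmul,
              List.length_append, List.length_append]
        | zero => rw [mul_zero]; exact zero_mem _
        | add y z _ _ hy hz => rw [mul_add]; exact add_mem hy hz
        | neg y _ hy => exact (mul_neg _ y).symm ▸ neg_mem hy
      | zero => rw [zero_mul]; exact zero_mem _
      | add x z _ _ hx hz => rw [add_mul]; exact add_mem hx hz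
      | neg x _ hx => exact (neg_mul x y).symm ▸ neg_mem hx
    refine (AddSubgroup.closure_le _).2 ?_
    rintro _ ⟨x, hx, y, hy, rfl⟩
    exact hclosure x hx y hy
  · refine (AddSubgroup.closure_le _).2 ?_
    rintro _ ⟨l, α, β, A, hA, -, -, hw, rfl⟩
    obtain ⟨γ, δ, rfl⟩ := exists_pathWord_eq g
    refine AddSubgroup.subset_closure
      ⟨l • mono R G γ A hA δ, AddSubgroup.subset_closure
        ⟨l, γ, δ, A, hA, hpath _, hpath _, rfl, rfl⟩,
      (1 : R) • mono R G (δ ++ α) A hA (γ ++ β), AddSubgroup.subset_closure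
        ⟨1, δ ++ α, γ ++ β, A, hA, hpath _, hpath _, ?_, rfl⟩, ?_⟩
    · rw [pathWord_append, pathWord_append, mul_inv_rev, mul_assoc, ← mul_assoc (pathWord α),
        hw, ← commute_freeGroup (pathWord γ)⁻¹]
      group
    · rw [smul_mul_smul_comm, mul_one, mono_eq_pow R hV, mono_eq_pow R hV, mono_eq_pow R hV,
        hmul, ← pow_add_mul_mul_pow_add hspt _ _ (γ.length + δ.length)]
      simp only [List.length_append]
      rw [add_comm α.length, add_comm β.length, ← add_assoc γ.length, ← add_assoc δ.length,
        add_comm δ.length γ.length]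

end SingleLoop

end Ultragraph

open Ultragraph in
/-- `L_R(𝒢)` is strongly graded by the free group on the edges iff `𝒢`
has exactly one edge `e` and exactly one vertex, with `r(e) = {s(e)}`. -/
theorem stronglyFGraded_iff {V E : Type} [Countable V] [Countable E]
    (G : Ultragraph V E) [Nonempty E] (R : Type) [CommRing R] [Nontrivial R] :
    (∀ g h : FreeGroup E, mulSpan (fComp R G g) (fComp R G h) = fComp R G (g * h)) ↔
      ∃ e : E, (∀ f : E, f = e) ∧ (∀ v : V, v = G.src e) ∧ G.rng e = {G.src e} := by
  constructor
  · intro H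
    have hone : ∀ g : FreeGroup E, mulSpan (fComp R G g) (fComp R G g⁻¹) = fComp R G 1 :=
      fun g => by rw [H, mul_inv_cancel]
    obtain ⟨e⟩ := ‹Nonempty E›
    have hE : Subsingleton E := by
      refine ⟨fun a b => by_contra fun hab => ?_⟩
      have h := pgen_mem_fComp_one (R := R) (G := G) {G.src e} (.vertex (G.src e))
      rw [← hone, fComp_inv_mul_eq_bot hab, mulSpan_bot_left] at h
      exact pgen_vertex_ne_zero R G _ h
    have hV : ∀ v : V, v = G.src e := by
      intro v
      by_contra hv
      have h := pgen_mem_fComp_one (R := R) (G := G) {v} (.vertex v)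
      rw [← hone (FreeGroup.of e)] at h
      refine pgen_vertex_ne_zero R G v ?_
      rw [← pgen_src_mul_of_mem_mulSpan h, pgen_vertex_mul_of_ne (Ne.symm hv)]
    exact ⟨e, fun f => Subsingleton.elim f e, hV, (InG0.range e).eq_singleton hV⟩
  · rintro ⟨e, hE, hV, -⟩
    have : Subsingleton E := ⟨fun a b => (hE a).trans (hE b).symm⟩
    exact mulSpan_fComp_of_single_loop R hV
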